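/- arXiv:1309.0976 — 2 statements merged into one kernel-verified Lean document; each statement's English description precedes it below -/
import Mathlib

section
/- Let 𝒞 be the class of sectors S ⊂ S^{n-1} (compact convex subsets of a hemisphere) satisfying S ⊇ S*, and define Φ(S,u) = (2/ω_n) ∫_S ⟨θ, u⟩ dσ(θ) for u ∈ S*. Then the infimum of Φ(S,u) over S ∈ 𝒞 and u ∈ S* is positive and is attained; moreover any minimizing pair (S₀, u₀) satisfies S₀ = S₀* and u₀ ∈ ∂S₀. -/
open RealInnerProductSpace Set MeasureTheory

/-- `ω n = 2 π^{n/2} / Γ(n/2)`, the surface measure of `S^{n-1}`. -/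
noncomputable def sphereMeasureConst (n : ℕ) : ℝ :=
  2 * Real.pi ^ ((n : ℝ) / 2) / Real.Gamma ((n : ℝ) / 2)

/-- A sector: a compact convex subset of a hemisphere of the unit sphere, i.e.
the intersection with the sphere of a convex cone contained in a half-space. -/
def IsSector {n : ℕ} (S : Set (EuclideanSpace ℝ (Fin n))) : Prop :=
  IsCompact S ∧
    (∃ C : Set (EuclideanSpace ℝ (Fin n)), Convex ℝ C ∧
      (∀ x ∈ C, ∀ r : ℝ, 0 ≤ r → r • x ∈ C) ∧
      S = C ∩ Metric.sphere (0 : EuclideanSpace ℝ (Fin n)) 1) ∧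
    ∃ e : EuclideanSpace ℝ (Fin n), ‖e‖ = 1 ∧ ∀ x ∈ S, 0 ≤ ⟪e, x⟫

/-- The dual sector of `S`. -/
def sectorDual {n : ℕ} (S : Set (EuclideanSpace ℝ (Fin n))) :
    Set (EuclideanSpace ℝ (Fin n)) :=
  {y ∈ Metric.sphere (0 : EuclideanSpace ℝ (Fin n)) 1 | ∀ x ∈ S, 0 ≤ ⟪y, x⟫}

/-- The functional `Φ(S, u) = (2/ω_n) ∫_S ⟨θ, u⟩ dσ(θ)`. -/
noncomputable def PhiFun {n : ℕ} (S : Set (EuclideanSpace ℝ (Fin n)))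
    (u : EuclideanSpace ℝ (Fin n)) : ℝ :=
  2 / sphereMeasureConst n * ∫ θ in S, ⟪θ, u⟫ ∂(μH[(n : ℝ) - 1])

section SphereMeasure

variable {E : Type*} [NormedAddCommGroup E] [InnerProductSpace ℝ E]

lemma lipschitzOnWith_normalize :
    LipschitzOnWith 1 (fun x : E => ‖x‖⁻¹ • x) {x | 1 ≤ ‖x‖} := by
  refine LipschitzOnWith.of_dist_le_mul fun x hx y hy => ?_
  simp only [mem_ofPred_eq] at hx hy
  rw [dist_eq_norm, dist_eq_norm, NNReal.coe_one, one_mul]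
  refine le_of_sq_le_sq ?_ (norm_nonneg _)
  have hx0 : ‖x‖ ≠ 0 := by positivity
  have hy0 : ‖y‖ ≠ 0 := by positivity
  rw [norm_sub_sq_real, norm_sub_sq_real, norm_smul, norm_smul, norm_inv, norm_inv, norm_norm,
    norm_norm, inv_mul_cancel₀ hx0, inv_mul_cancel₀ hy0, real_inner_smul_left,
    real_inner_smul_right]
  have hxy : 1 ≤ ‖x‖ * ‖y‖ := by nlinarith
  have hin : ⟪x, y⟫ ≤ ‖x‖ * ‖y‖ := real_inner_le_norm x y
  have hle : ‖x‖⁻¹ * (‖y‖⁻¹ * ⟪x, y⟫) = ⟪x, y⟫ / (‖x‖ * ‖y‖) := by field_simp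
  have hdiv : ‖x‖ * ‖y‖ - ⟪x, y⟫ ≥ 1 - ⟪x, y⟫ / (‖x‖ * ‖y‖) := by
    have : 1 - ⟪x, y⟫ / (‖x‖ * ‖y‖) = (‖x‖ * ‖y‖ - ⟪x, y⟫) / (‖x‖ * ‖y‖) := by field_simp
    rw [this]
    exact div_le_self (by linarith) hxy
  rw [hle]
  nlinarith [sq_nonneg (‖x‖ - ‖y‖)]

/-- The inverse of the central projection of the sphere onto its tangent hyperplane at `e`. -/
noncomputable def gnomonic (e : E) (y : (ℝ ∙ e)ᗮ) : E := ‖e + y‖⁻¹ • (e + (y : E))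

lemma inner_self_add_orthogonal {e : E} (he : ‖e‖ = 1) (y : (ℝ ∙ e)ᗮ) : ⟪e + (y : E), e⟫ = 1 := by
  have h : ⟪(y : E), e⟫ = 0 := by
    rw [real_inner_comm]; exact Submodule.mem_orthogonal_singleton_iff_inner_right.1 y.2
  rw [inner_add_left, h, real_inner_self_eq_norm_sq, he]; norm_num

lemma one_le_norm_add_orthogonal {e : E} (he : ‖e‖ = 1) (y : (ℝ ∙ e)ᗮ) : 1 ≤ ‖e + (y : E)‖ := by
  have := real_inner_le_norm (e + (y : E)) e
  rwa [inner_self_add_orthogonal he, he, mul_one] at this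

lemma lipschitzWith_gnomonic {e : E} (he : ‖e‖ = 1) : LipschitzWith 1 (gnomonic e) := by
  have h : LipschitzWith 1 fun y : (ℝ ∙ e)ᗮ => e + (y : E) :=
    LipschitzWith.of_dist_le_mul fun x y => by simp [Subtype.dist_eq]
  have := (lipschitzOnWith_normalize (E := E)).comp (h.lipschitzOnWith (s := univ))
    (fun y _ => one_le_norm_add_orthogonal he y)
  rw [one_mul] at this
  exact lipschitzOnWith_univ.1 this

lemma exists_gnomonic_eq {e z : E} (he : ‖e‖ = 1) (hz : ‖z‖ = 1) (hze : 1 / 2 < ⟪z, e⟫) :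
    ∃ y : (ℝ ∙ e)ᗮ, ‖y‖ ≤ 3 ∧ gnomonic e y = z := by
  have h0 : ⟪z, e⟫ ≠ 0 := by linarith
  have hpos : 0 < ⟪z, e⟫⁻¹ := inv_pos.2 (by linarith)
  have hinv : ⟪z, e⟫⁻¹ ≤ 2 := by
    rw [inv_le_comm₀ (by linarith) (by norm_num)]; linarith
  refine ⟨⟨⟪z, e⟫⁻¹ • z - e, ?_⟩, ?_, ?_⟩
  · rw [Submodule.mem_orthogonal_singleton_iff_inner_left, inner_sub_left, real_inner_smul_left,
      inv_mul_cancel₀ h0, real_inner_self_eq_norm_sq, he]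
    norm_num
  · change ‖⟪z, e⟫⁻¹ • z - e‖ ≤ 3
    refine (norm_sub_le _ _).trans ?_
    rw [norm_smul, hz, he, Real.norm_of_nonneg hpos.le]
    linarith
  · simp only [gnomonic, add_sub_cancel]
    rw [norm_smul, hz, mul_one, Real.norm_of_nonneg hpos.le, inv_inv, smul_smul, mul_inv_cancel₀ h0,
      one_smul]

variable [FiniteDimensional ℝ E] [MeasurableSpace E] [BorelSpace E] {m : ℕ}

lemma isAddHaarMeasure_hausdorffMeasure_orthogonal [Fact (Module.finrank ℝ E = m + 1)] {e : E}
    (he : ‖e‖ = 1) : (μH[(m : ℝ)] : Measure (ℝ ∙ e)ᗮ).IsAddHaarMeasure := by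
  have h : Module.finrank ℝ (ℝ ∙ e)ᗮ = m :=
    Submodule.finrank_orthogonal_span_singleton (norm_ne_zero_iff.1 (by simp [he]))
  have := isAddHaarMeasure_hausdorffMeasure (E := (ℝ ∙ e)ᗮ)
  rwa [h] at this

lemma hausdorffMeasure_sphere_lt_top [Fact (Module.finrank ℝ E = m + 1)] :
    μH[(m : ℝ)] (Metric.sphere (0 : E) 1) < ⊤ := by
  have : ProperSpace E := FiniteDimensional.proper ℝ E
  refine (isCompact_sphere (0 : E) 1).measure_lt_top_of_nhdsWithin fun e he => ?_
  rw [mem_sphere_zero_iff_norm] at he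
  have := isAddHaarMeasure_hausdorffMeasure_orthogonal (m := m) he
  refine ⟨gnomonic e '' Metric.closedBall 0 3, ?_, ?_⟩
  · have hU : {z : E | 1 / 2 < ⟪z, e⟫} ∈ nhds e :=
      (isOpen_lt (by fun_prop) (by fun_prop)).mem_nhds
        (by simp only [mem_ofPred_eq, real_inner_self_eq_norm_sq, he]; norm_num)
    filter_upwards [self_mem_nhdsWithin, mem_nhdsWithin_of_mem_nhds hU] with z hz hze
    obtain ⟨y, hy, rfl⟩ := exists_gnomonic_eq he (mem_sphere_zero_iff_norm.1 hz) hze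
    exact mem_image_of_mem _ (by simpa using hy)
  · refine ((lipschitzWith_gnomonic he).hausdorffMeasure_image_le m.cast_nonneg _).trans_lt ?_
    simpa using (isCompact_closedBall _ _).measure_lt_top

lemma hausdorffMeasure_sphere_inter_pos [Fact (Module.finrank ℝ E = m + 1)] {V : Set E}
    (hV : IsOpen V) (hne : (Metric.sphere (0 : E) 1 ∩ V).Nonempty) :
    0 < μH[(m : ℝ)] (Metric.sphere (0 : E) 1 ∩ V) := by
  obtain ⟨e, he, heV⟩ := hne
  rw [mem_sphere_zero_iff_norm] at he
  have := isAddHaarMeasure_hausdorffMeasure_orthogonal (m := m) he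
  let g : (ℝ ∙ e)ᗮ → E := fun y => √(1 - ‖y‖ ^ 2) • e + (y : E)
  have hg : Continuous g := by fun_prop
  let P : E →L[ℝ] (ℝ ∙ e)ᗮ := (ℝ ∙ e)ᗮ.orthogonalProjectionOnto
  have hP : LipschitzWith 1 P :=
    P.lipschitz.weaken (Submodule.orthogonalProjectionOnto_norm_le _)
  have hopen : IsOpen (Metric.ball 0 1 ∩ g ⁻¹' V) := Metric.isOpen_ball.inter (hV.preimage hg)
  have hpos : 0 < μH[(m : ℝ)] (Metric.ball 0 1 ∩ g ⁻¹' V) :=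
    hopen.measure_pos _ ⟨0, by simp, by simpa [g] using heV⟩
  have hsub : Metric.ball 0 1 ∩ g ⁻¹' V ⊆ P '' (Metric.sphere (0 : E) 1 ∩ V) := by
    rintro y ⟨hy, hyV⟩
    refine ⟨g y, ⟨?_, hyV⟩, ?_⟩
    · have hy1 : ‖y‖ < 1 := by simpa using hy
      have h : ⟪e, (y : E)⟫ = 0 := Submodule.mem_orthogonal_singleton_iff_inner_right.1 y.2
      have hsq : ‖g y‖ ^ 2 = 1 := by
        simp only [g]
        rw [norm_add_sq_real, real_inner_smul_left, h, norm_smul, he, mul_one, Real.norm_eq_abs,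
          sq_abs, Real.sq_sqrt (by nlinarith [norm_nonneg y]), Submodule.coe_norm]
        ring
      rw [mem_sphere_zero_iff_norm]
      exact (pow_eq_one_iff_of_nonneg (norm_nonneg _) two_ne_zero).1 hsq
    · have he0 : P e = 0 := by
        simp only [P]
        rw [Submodule.orthogonalProjectionOnto_eq_zero_iff, Submodule.orthogonal_orthogonal]
        exact Submodule.mem_span_singleton_self e
      have hPy : P (y : E) = y := Submodule.orthogonalProjectionOnto_mem_subspace_eq_self y
      simp only [g, map_add, map_smul, he0, hPy, smul_zero, zero_add]
  have := (hpos.trans_le (measure_mono hsub)).trans_le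
    (hP.hausdorffMeasure_image_le m.cast_nonneg _)
  simpa using this

lemma hausdorffMeasure_dual_boundary_eq_zero [Fact (Module.finrank ℝ E = m + 1)] {D : Set E}
    (hD : (0 : E) ∉ D) :
    μH[(m : ℝ)] {z ∈ Metric.sphere (0 : E) 1 | (∀ d ∈ D, 0 ≤ ⟪z, d⟫) ∧ ∃ d ∈ D, ⟪z, d⟫ = 0} = 0 := by
  refine measure_null_of_locally_null _ fun e he => ?_
  have he := mem_sphere_zero_iff_norm.1 he.1
  have := isAddHaarMeasure_hausdorffMeasure_orthogonal (m := m) he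
  let K : Set (ℝ ∙ e)ᗮ := {y | ∀ d ∈ D, 0 ≤ ⟪e + (y : E), d⟫}
  have hK : Convex ℝ K := by
    intro x hx y hy a b ha hb hab d hd
    have : ⟪e + ((a • x + b • y : (ℝ ∙ e)ᗮ) : E), d⟫
        = a * ⟪e + (x : E), d⟫ + b * ⟪e + (y : E), d⟫ := by
      simp only [Submodule.coe_add, Submodule.coe_smul, inner_add_left, real_inner_smul_left]
      linear_combination (-⟪e, d⟫) * hab
    rw [this]
    exact add_nonneg (mul_nonneg ha (hx d hd)) (mul_nonneg hb (hy d hd))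
  refine ⟨gnomonic e '' frontier K, ?_, ?_⟩
  · have hU : {z : E | 1 / 2 < ⟪z, e⟫} ∈ nhds e :=
      (isOpen_lt (by fun_prop) (by fun_prop)).mem_nhds
        (by simp only [mem_ofPred_eq, real_inner_self_eq_norm_sq, he]; norm_num)
    filter_upwards [self_mem_nhdsWithin, mem_nhdsWithin_of_mem_nhds hU] with z hz hze
    obtain ⟨hz1, hz2, d, hd, hzd⟩ := hz
    obtain ⟨y, -, rfl⟩ := exists_gnomonic_eq he (mem_sphere_zero_iff_norm.1 hz1) hze
    have hn : 0 < ‖e + (y : E)‖⁻¹ := inv_pos.2 (by linarith [one_le_norm_add_orthogonal he y])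
    simp only [gnomonic, real_inner_smul_left] at hz2 hzd
    have hyd : ⟪e + (y : E), d⟫ = 0 := (mul_eq_zero.1 hzd).resolve_left hn.ne'
    refine mem_image_of_mem _ ⟨subset_closure fun d hd =>
      nonneg_of_mul_nonneg_right (hz2 d hd) hn, fun hint => ?_⟩
    let p : (ℝ ∙ e)ᗮ := (ℝ ∙ e)ᗮ.orthogonalProjectionOnto d
    have hcont : Filter.Tendsto (fun t : ℝ => y - t • p) (nhdsWithin 0 (Ioi 0)) (nhds y) := by
      refine Filter.Tendsto.mono_left ?_ nhdsWithin_le_nhds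
      have : Continuous fun t : ℝ => y - t • p := by fun_prop
      simpa using this.tendsto 0
    obtain ⟨t, htK, ht⟩ := ((hcont.eventually (mem_interior_iff_mem_nhds.1 hint)).and
      self_mem_nhdsWithin).exists
    have h1 := htK d hd
    have hpd : ⟪(p : E), d⟫ = ‖p‖ ^ 2 := by
      rw [← real_inner_self_eq_norm_sq]
      exact (Submodule.inner_orthogonalProjectionOnto_eq_of_mem_left p d).symm
    have h2 : ⟪e + ((y - t • p : (ℝ ∙ e)ᗮ) : E), d⟫ = - (t * ‖p‖ ^ 2) := by
      rw [Submodule.coe_sub, ← add_sub_assoc, inner_sub_left, hyd, Submodule.coe_smul,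
        real_inner_smul_left, hpd]
      ring
    rw [h2] at h1
    have hp : p = 0 := by
      rw [← norm_eq_zero]
      have : ‖p‖ ^ 2 ≤ 0 := by
        have ht : 0 < t := ht
        by_contra! h
        nlinarith [mul_pos ht h]
      exact pow_eq_zero_iff two_ne_zero |>.1 (le_antisymm this (sq_nonneg _))
    have hde : d ∈ ℝ ∙ e := by
      rw [← Submodule.orthogonal_orthogonal (ℝ ∙ e)]
      exact Submodule.orthogonalProjectionOnto_eq_zero_iff.1 hp
    obtain ⟨c, rfl⟩ := Submodule.mem_span_singleton.1 hde
    rw [real_inner_smul_right, inner_self_add_orthogonal he, mul_one] at hyd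
    exact hD (by simpa [hyd] using hd)
  · refine le_antisymm
      (((lipschitzWith_gnomonic he).hausdorffMeasure_image_le m.cast_nonneg _).trans ?_) zero_le
    rw [hK.addHaar_frontier (μH[(m : ℝ)])]; simp

end SphereMeasure

section Sectors

variable {n : ℕ} {S D : Set (EuclideanSpace ℝ (Fin n))} {u : EuclideanSpace ℝ (Fin n)}

lemma surfaceMeasure_sphere_lt_top (hn : n ≠ 0) :
    μH[(n : ℝ) - 1] (Metric.sphere (0 : EuclideanSpace ℝ (Fin n)) 1) < ⊤ := by
  obtain ⟨m, rfl⟩ := Nat.exists_eq_succ_of_ne_zero hn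
  have : Fact (Module.finrank ℝ (EuclideanSpace ℝ (Fin (m + 1))) = m + 1) := ⟨by simp⟩
  simpa using hausdorffMeasure_sphere_lt_top (E := EuclideanSpace ℝ (Fin (m + 1))) (m := m)

lemma surfaceMeasure_sphere_inter_pos (hn : n ≠ 0) {V : Set (EuclideanSpace ℝ (Fin n))}
    (hV : IsOpen V) (hne : (Metric.sphere 0 1 ∩ V).Nonempty) :
    0 < μH[(n : ℝ) - 1] (Metric.sphere 0 1 ∩ V) := by
  obtain ⟨m, rfl⟩ := Nat.exists_eq_succ_of_ne_zero hn
  have : Fact (Module.finrank ℝ (EuclideanSpace ℝ (Fin (m + 1))) = m + 1) := ⟨by simp⟩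
  simpa using hausdorffMeasure_sphere_inter_pos (m := m) hV hne

lemma surfaceMeasure_dual_boundary_eq_zero (hn : n ≠ 0) (hD : 0 ∉ D) :
    μH[(n : ℝ) - 1] {z ∈ Metric.sphere (0 : EuclideanSpace ℝ (Fin n)) 1 |
      (∀ d ∈ D, 0 ≤ ⟪z, d⟫) ∧ ∃ d ∈ D, ⟪z, d⟫ = 0} = 0 := by
  obtain ⟨m, rfl⟩ := Nat.exists_eq_succ_of_ne_zero hn
  have : Fact (Module.finrank ℝ (EuclideanSpace ℝ (Fin (m + 1))) = m + 1) := ⟨by simp⟩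
  simpa using hausdorffMeasure_dual_boundary_eq_zero (m := m) hD

lemma mem_sectorDual {y : EuclideanSpace ℝ (Fin n)} :
    y ∈ sectorDual S ↔ ‖y‖ = 1 ∧ ∀ x ∈ S, 0 ≤ ⟪y, x⟫ := by
  simp [sectorDual]

lemma sectorDual_subset_sphere : sectorDual S ⊆ Metric.sphere 0 1 := fun _ h => h.1

lemma isCompact_sectorDual : IsCompact (sectorDual S) := by
  refine (isCompact_sphere 0 1).of_isClosed_subset ?_ sectorDual_subset_sphere
  have : sectorDual S = Metric.sphere 0 1 ∩ ⋂ x ∈ S, {y | 0 ≤ ⟪y, x⟫} := by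
    ext y; simp [sectorDual]
  rw [this]
  exact Metric.isClosed_sphere.inter <| isClosed_biInter fun x _ =>
    isClosed_le (by fun_prop) (by fun_prop)

lemma IsSector.subset_sphere (hS : IsSector S) : S ⊆ Metric.sphere 0 1 := by
  obtain ⟨-, ⟨C, -, -, rfl⟩, -⟩ := hS
  exact inter_subset_right

lemma IsSector.nonempty_sectorDual (hS : IsSector S) : (sectorDual S).Nonempty := by
  obtain ⟨-, -, e, he, h⟩ := hS
  exact ⟨e, mem_sectorDual.2 ⟨he, h⟩⟩

lemma isSector_sectorDual (hne : D.Nonempty) (hD : D ⊆ Metric.sphere 0 1) :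
    IsSector (sectorDual D) := by
  refine ⟨isCompact_sectorDual, ⟨{x | ∀ d ∈ D, 0 ≤ ⟪x, d⟫}, ?_, ?_, ?_⟩, ?_⟩
  · intro x hx y hy a b ha hb _ d hd
    rw [inner_add_left, real_inner_smul_left, real_inner_smul_left]
    exact add_nonneg (mul_nonneg ha (hx d hd)) (mul_nonneg hb (hy d hd))
  · intro x hx r hr d hd
    rw [real_inner_smul_left]
    exact mul_nonneg hr (hx d hd)
  · ext y
    simp [sectorDual, and_comm]
  · obtain ⟨d, hd⟩ := hne
    refine ⟨d, mem_sphere_zero_iff_norm.1 (hD hd), fun x hx => ?_⟩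
    rw [real_inner_comm]
    exact hx.2 d hd

lemma IsSector.sectorDual_sectorDual (hS : IsSector S) (hne : S.Nonempty) :
    sectorDual (sectorDual S) = S := by
  apply subset_antisymm
  · obtain ⟨hc, ⟨C, hconv, hcone, rfl⟩, -⟩ := hS
    obtain ⟨p, hp, -⟩ := hne
    have h0 : (0 : EuclideanSpace ℝ (Fin n)) ∈ C := by simpa using hcone p hp 0 le_rfl
    have hclosed : IsClosed C := by
      refine isClosed_of_closure_subset fun x hx => ?_
      rcases eq_or_ne x 0 with rfl | hx0
      · exact h0
      obtain ⟨y, hyC, hy⟩ := mem_closure_iff_seq_limit.1 hx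
      have hn : Filter.Tendsto (fun k => ‖y k‖⁻¹ • y k) Filter.atTop (nhds (‖x‖⁻¹ • x)) :=
        (hy.norm.inv₀ (norm_ne_zero_iff.2 hx0)).smul hy
      have hmem : ‖x‖⁻¹ • x ∈ C ∩ Metric.sphere 0 1 := by
        refine hc.isClosed.mem_of_tendsto hn ?_
        filter_upwards [hy.eventually_ne hx0] with k hk
        exact ⟨hcone _ (hyC k) _ (by positivity), by simp [norm_smul, hk]⟩
      have := hcone _ hmem.1 ‖x‖ (norm_nonneg x)
      rwa [smul_smul, mul_inv_cancel₀ (norm_ne_zero_iff.2 hx0), one_smul] at this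
    let K : ProperCone ℝ (EuclideanSpace ℝ (Fin n)) :=
      { carrier := C
        add_mem' := by
          intro a b ha hb
          have := hcone _ (hconv ha hb (by norm_num : (0 : ℝ) ≤ 1 / 2) (by norm_num : (0 : ℝ) ≤ 1 / 2)
            (by norm_num)) 2 (by norm_num)
          rw [smul_add, smul_smul, smul_smul] at this
          norm_num at this
          exact this
        zero_mem' := h0
        smul_mem' := fun c x hx => hcone x hx c c.2
        isClosed' := hclosed }
    intro z hz
    rw [mem_sectorDual] at hz
    refine ⟨?_, mem_sphere_zero_iff_norm.2 hz.1⟩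
    by_contra hzC
    obtain ⟨y, hy, hzy⟩ := K.hyperplane_separation' (x₀ := z) hzC
    have hy0 : y ≠ 0 := by rintro rfl; simp at hzy
    have hyn : 0 < ‖y‖⁻¹ := inv_pos.2 (norm_pos_iff.2 hy0)
    have hmem : ‖y‖⁻¹ • y ∈ sectorDual (C ∩ Metric.sphere 0 1) := by
      refine mem_sectorDual.2 ⟨by simp [norm_smul, hy0], fun x hx => ?_⟩
      rw [real_inner_smul_left, real_inner_comm]
      exact mul_nonneg hyn.le (hy x hx.1)
    have := hz.2 _ hmem
    rw [real_inner_smul_right] at this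
    nlinarith
  · intro x hx
    refine mem_sectorDual.2 ⟨mem_sphere_zero_iff_norm.1 (hS.subset_sphere hx), fun y hy => ?_⟩
    rw [real_inner_comm]
    exact hy.2 x hx

lemma IsSector.inter_halfSpace (hS : IsSector S) (x : EuclideanSpace ℝ (Fin n)) :
    IsSector (S ∩ {z | 0 ≤ ⟪z, x⟫}) := by
  obtain ⟨hc, ⟨C, hconv, hcone, hSC⟩, e, he, h⟩ := hS
  refine ⟨hc.inter_right (isClosed_le (by fun_prop) (by fun_prop)),
    ⟨C ∩ {z | 0 ≤ ⟪z, x⟫}, hconv.inter ?_, ?_, ?_⟩, e, he, fun z hz => h z hz.1⟩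
  · intro y hy z hz a b ha hb _
    rw [mem_ofPred_eq, inner_add_left, real_inner_smul_left, real_inner_smul_left]
    exact add_nonneg (mul_nonneg ha hy) (mul_nonneg hb hz)
  · intro y hy r hr
    refine ⟨hcone y hy.1 r hr, ?_⟩
    rw [mem_ofPred_eq, real_inner_smul_left]
    exact mul_nonneg hr hy.2
  · rw [hSC, inter_right_comm]

lemma isOpen_forall_inner_pos {E : Type*} [NormedAddCommGroup E] [InnerProductSpace ℝ E]
    {K : Set E} (hK : IsCompact K) : IsOpen {z : E | ∀ d ∈ K, 0 < ⟪z, d⟫} := by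
  rw [isOpen_iff_mem_nhds]
  intro z hz
  refine hK.eventually_forall_of_forall_eventually fun d hd => ?_
  have : Continuous fun p : E × E => ⟪p.1, p.2⟫ := by fun_prop
  exact this.continuousAt.eventually_const_lt (hz d hd)

lemma exists_forall_inner_pos {E : Type*} [NormedAddCommGroup E] [InnerProductSpace ℝ E]
    {K : Set E} (hK : IsCompact K) (hsph : K ⊆ Metric.sphere 0 1)
    (hacute : ∀ a ∈ K, ∀ b ∈ K, 0 ≤ ⟪a, b⟫) : ∃ w : E, ∀ d ∈ K, 0 < ⟪w, d⟫ := by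
  obtain ⟨t, htK, htfin, ht⟩ := hK.finite_cover_balls one_pos
  refine ⟨∑ b ∈ htfin.toFinset, b, fun d hd => ?_⟩
  rw [sum_inner]
  refine Finset.sum_pos' (fun b hb => hacute b (htK (htfin.mem_toFinset.1 hb)) d hd) ?_
  obtain ⟨b, hb, hdb⟩ := mem_iUnion₂.1 (ht hd)
  refine ⟨b, htfin.mem_toFinset.2 hb, ?_⟩
  have h1 := norm_sub_sq_real d b
  rw [mem_sphere_zero_iff_norm.1 (hsph hd), mem_sphere_zero_iff_norm.1 (hsph (htK hb)),
    real_inner_comm] at h1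
  have h2 : ‖d - b‖ < 1 := by simpa [dist_eq_norm] using hdb
  nlinarith [norm_nonneg (d - b)]

lemma IsSector.sphere_inter_nonempty (hS : IsSector S) (hdual : sectorDual S ⊆ S)
    {V : Set (EuclideanSpace ℝ (Fin n))} (hV : IsOpen V) (hne : (S ∩ V).Nonempty) :
    (Metric.sphere 0 1 ∩ ({z | ∀ d ∈ sectorDual S, 0 < ⟪z, d⟫} ∩ V)).Nonempty := by
  obtain ⟨y, hyS, hyV⟩ := hne
  obtain ⟨w, hw⟩ := exists_forall_inner_pos (isCompact_sectorDual (S := S))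
    sectorDual_subset_sphere fun a ha b hb => ha.2 b (hdual hb)
  have hy1 := mem_sphere_zero_iff_norm.1 (hS.subset_sphere hyS)
  have hy0 : y ≠ 0 := norm_ne_zero_iff.1 (by simp [hy1])
  have h1 : Filter.Tendsto (fun t : ℝ => y + t • w) (nhdsWithin 0 (Ioi 0)) (nhds y) := by
    refine Filter.Tendsto.mono_left ?_ nhdsWithin_le_nhds
    have : Continuous fun t : ℝ => y + t • w := by fun_prop
    simpa using this.tendsto 0
  have h2 : Filter.Tendsto (fun t : ℝ => ‖y + t • w‖⁻¹ • (y + t • w)) (nhdsWithin 0 (Ioi 0))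
      (nhds y) := by
    simpa [hy1] using (h1.norm.inv₀ (norm_ne_zero_iff.2 hy0)).smul h1
  obtain ⟨t, ⟨htV, ht0⟩, ht⟩ := ((h2.eventually (hV.mem_nhds hyV)).and
    (h1.eventually_ne hy0)).and self_mem_nhdsWithin |>.exists
  refine ⟨_, ?_, fun d hd => ?_, htV⟩
  · rw [mem_sphere_zero_iff_norm, norm_smul, norm_inv, norm_norm,
      inv_mul_cancel₀ (norm_ne_zero_iff.2 ht0)]
  rw [real_inner_smul_left, inner_add_left, real_inner_smul_left]
  have ht : 0 < t := ht
  have := hw d hd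
  have hyd : 0 ≤ ⟪y, d⟫ := by rw [real_inner_comm]; exact hd.2 y hyS
  positivity

lemma IsSector.integrableOn_inner (hn : n ≠ 0) (hS : IsSector S) (u : EuclideanSpace ℝ (Fin n)) :
    IntegrableOn (fun θ => ⟪θ, u⟫) S μH[(n : ℝ) - 1] := by
  refine Measure.integrableOn_of_bounded (M := ‖u‖)
    ((measure_mono hS.subset_sphere).trans_lt (surfaceMeasure_sphere_lt_top hn)).ne ?_ ?_
  · exact Continuous.aestronglyMeasurable (by fun_prop)
  · filter_upwards [self_mem_ae_restrict hS.1.measurableSet] with θ hθ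
    simpa [mem_sphere_zero_iff_norm.1 (hS.subset_sphere hθ)] using norm_inner_le_norm (𝕜 := ℝ) θ u

lemma IsSector.setIntegral_inner_pos (hn : n ≠ 0) (hS : IsSector S) (hdual : sectorDual S ⊆ S)
    (hu : u ∈ sectorDual S) {V : Set (EuclideanSpace ℝ (Fin n))} (hV : IsOpen V)
    (hne : (S ∩ V).Nonempty) : 0 < ∫ θ in S ∩ V, ⟪θ, u⟫ ∂(μH[(n : ℝ) - 1]) := by
  rw [setIntegral_pos_iff_support_of_nonneg_ae]
  · have h := surfaceMeasure_sphere_inter_pos hn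
      ((isOpen_forall_inner_pos (isCompact_sectorDual (S := S))).inter hV)
      (hS.sphere_inter_nonempty hdual hV hne)
    refine h.trans_le (measure_mono ?_)
    rintro z ⟨hz1, hz, hzV⟩
    refine ⟨(hz u hu).ne', ?_, hzV⟩
    rw [← hS.sectorDual_sectorDual (hne.mono inter_subset_left)]
    exact ⟨hz1, fun d hd => (hz d hd).le⟩
  · filter_upwards [self_mem_ae_restrict (hS.1.measurableSet.inter hV.measurableSet)] with θ hθ
    rw [Pi.zero_apply, real_inner_comm]
    exact hu.2 θ hθ.1
  · exact (hS.integrableOn_inner hn u).mono_set inter_subset_left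

lemma two_div_sphereMeasureConst_pos (hn : n ≠ 0) : 0 < 2 / sphereMeasureConst n := by
  have : (0 : ℝ) < n := by positivity
  have := Real.Gamma_pos_of_pos (half_pos this)
  unfold sphereMeasureConst
  positivity

lemma IsSector.phiFun_pos (hn : n ≠ 0) (hS : IsSector S) (hdual : sectorDual S ⊆ S)
    (hu : u ∈ sectorDual S) : 0 < PhiFun S u := by
  refine mul_pos (two_div_sphereMeasureConst_pos hn) ?_
  simpa using hS.setIntegral_inner_pos hn hdual hu isOpen_univ ⟨u, hdual hu, mem_univ u⟩

/-- A sector that strictly contains its dual can be cut down to a smaller admissible one. -/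
lemma IsSector.exists_phiFun_lt (hn : n ≠ 0) (hS : IsSector S) (hdual : sectorDual S ⊆ S)
    (hu : u ∈ sectorDual S) (hne : S ≠ sectorDual S) :
    ∃ T, IsSector T ∧ sectorDual T ⊆ T ∧ u ∈ sectorDual T ∧ PhiFun T u < PhiFun S u := by
  obtain ⟨x, hxS, hx⟩ : ∃ x ∈ S, x ∉ sectorDual S := by
    by_contra! h
    exact hne (subset_antisymm h hdual)
  have hx1 := hS.subset_sphere hxS
  refine ⟨S ∩ {z | 0 ≤ ⟪z, x⟫}, hS.inter_halfSpace x, fun y hy => ⟨?_, ?_⟩,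
    ⟨hu.1, fun z hz => hu.2 z hz.1⟩, ?_⟩
  · rw [← hS.sectorDual_sectorDual ⟨x, hxS⟩]
    exact ⟨hy.1, fun k hk => hy.2 k ⟨hdual hk, hk.2 x hxS⟩⟩
  · exact hy.2 x ⟨hxS, real_inner_self_nonneg⟩
  · have hV : IsOpen {z : EuclideanSpace ℝ (Fin n) | ⟪z, x⟫ < 0} :=
      isOpen_lt (by fun_prop) (by fun_prop)
    have hpos := hS.setIntegral_inner_pos hn hdual hu hV <| by
      by_contra! h
      refine hx ⟨hx1, fun z hz => ?_⟩
      by_contra! hlt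
      rw [real_inner_comm] at hlt
      exact (h.subset ⟨hz, hlt⟩ : z ∈ (∅ : Set _))
    have hsplit := integral_inter_add_sdiff (μ := μH[(n : ℝ) - 1]) hV.measurableSet
      (hS.integrableOn_inner hn u)
    have hdiff : S \ {z | ⟪z, x⟫ < 0} = S ∩ {z | 0 ≤ ⟪z, x⟫} := by
      ext z; simp
    rw [hdiff] at hsplit
    exact mul_lt_mul_of_pos_left (by linarith) (two_div_sphereMeasureConst_pos hn)

/-- On a self-dual sector, moving away from an interior point decreases `Φ`. -/
lemma IsSector.exists_phiFun_lt_of_interior (hn : 2 ≤ n) (hS : IsSector S)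
    (hself : S = sectorDual S) (hu : u ∈ sectorDual S)
    (hint : u ∉ closure (Metric.sphere (0 : EuclideanSpace ℝ (Fin n)) 1 \ S)) :
    ∃ v ∈ sectorDual S, PhiFun S v < PhiFun S u := by
  have hn0 : n ≠ 0 := by omega
  have hu1 := mem_sphere_zero_iff_norm.1 hu.1
  obtain ⟨v, hv, huv⟩ : ∃ v : EuclideanSpace ℝ (Fin n), ‖v‖ = 1 ∧ ⟪u, v⟫ = 0 := by
    have hlt : 0 < Module.finrank ℝ (ℝ ∙ u)ᗮ := by
      have h1 := Submodule.finrank_add_finrank_orthogonal (ℝ ∙ u)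
      have h2 := finrank_span_singleton (K := ℝ) (norm_ne_zero_iff.1 (by simp [hu1]) : u ≠ 0)
      rw [finrank_euclideanSpace_fin] at h1
      omega
    have := Module.nontrivial_of_finrank_pos hlt
    obtain ⟨v, hv⟩ := exists_norm_eq (ℝ ∙ u)ᗮ (zero_le_one (α := ℝ))
    exact ⟨v, hv, Submodule.mem_orthogonal_singleton_iff_inner_right.1 v.2⟩
  let γ : ℝ → EuclideanSpace ℝ (Fin n) := fun t => Real.cos t • u + Real.sin t • v
  have hγ : Continuous γ := by fun_prop
  have hγ1 : ∀ t, ‖γ t‖ = 1 := by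
    intro t
    refine (pow_eq_one_iff_of_nonneg (norm_nonneg _) two_ne_zero).1 ?_
    simp only [γ]
    rw [norm_add_sq_real, real_inner_smul_left, real_inner_smul_right, huv, norm_smul, norm_smul,
      hu1, hv]
    simp
  have hγS : ∀ᶠ t in nhds 0, γ t ∈ sectorDual S := by
    have h := hγ.continuousAt.eventually_mem (x := 0)
      (isClosed_closure.isOpen_compl.mem_nhds (by simpa [γ] using hint))
    filter_upwards [h] with t ht
    rw [← hself]
    by_contra hmem
    exact ht (subset_closure ⟨mem_sphere_zero_iff_norm.2 (hγ1 t), hmem⟩)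
  have hΦ : ∀ t, PhiFun S (γ t) = Real.cos t * PhiFun S u + Real.sin t * PhiFun S v := by
    intro t
    simp only [PhiFun, γ, inner_add_right, real_inner_smul_right]
    rw [integral_add ((hS.integrableOn_inner hn0 u).const_mul _)
      ((hS.integrableOn_inner hn0 v).const_mul _), integral_const_mul, integral_const_mul]
    ring
  have hpos := hS.phiFun_pos hn0 hself.symm.subset hu
  have hneg : ∀ᶠ t in nhds (0 : ℝ), γ (-t) ∈ sectorDual S := by
    have : Filter.Tendsto (fun t : ℝ => -t) (nhds 0) (nhds 0) := by
      simpa using (continuous_neg (G := ℝ)).tendsto 0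
    exact this.eventually hγS
  have hsmall : ∀ᶠ t in nhdsWithin (0 : ℝ) (Ioi 0), t ∈ Ioo (0 : ℝ) 1 :=
    Ioo_mem_nhdsGT one_pos
  obtain ⟨t, ⟨ht1, ht2⟩, ht0, htlt⟩ :=
    (((hγS.and hneg).filter_mono nhdsWithin_le_nhds).and hsmall).exists
  have hsin : 0 < Real.sin t := Real.sin_pos_of_pos_of_lt_pi ht0 (by linarith [Real.pi_gt_three])
  have hcos : Real.cos t < 1 := by nlinarith [Real.sin_sq_add_cos_sq t]
  rcases le_total (PhiFun S v) 0 with hv0 | hv0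
  · refine ⟨γ t, ht1, ?_⟩
    rw [hΦ]
    nlinarith
  · refine ⟨γ (-t), ht2, ?_⟩
    rw [hΦ, Real.cos_neg, Real.sin_neg]
    nlinarith

lemma continuousAt_phiFun_sectorDual (hn : n ≠ 0)
    (p : TopologicalSpace.NonemptyCompacts (EuclideanSpace ℝ (Fin n)) × EuclideanSpace ℝ (Fin n))
    (hp : (0 : EuclideanSpace ℝ (Fin n)) ∉ (p.1 : Set (EuclideanSpace ℝ (Fin n)))) :
    ContinuousAt
      (fun q : TopologicalSpace.NonemptyCompacts (EuclideanSpace ℝ (Fin n)) ×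
        EuclideanSpace ℝ (Fin n) => PhiFun (sectorDual (q.1 : Set (EuclideanSpace ℝ (Fin n)))) q.2)
      p := by
  unfold PhiFun
  refine continuousAt_const.mul ?_
  simp_rw [← integral_indicator isCompact_sectorDual.measurableSet]
  refine continuousAt_of_dominated
    (bound := (Metric.sphere (0 : EuclideanSpace ℝ (Fin n)) 1).indicator fun _ => ‖p.2‖ + 1)
    (.of_forall fun q => ?_) ?_ ?_ ?_
  · exact (Continuous.aestronglyMeasurable (by fun_prop)).indicator
      isCompact_sectorDual.measurableSet
  · have h : ∀ᶠ q : TopologicalSpace.NonemptyCompacts (EuclideanSpace ℝ (Fin n)) ×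
        EuclideanSpace ℝ (Fin n) in nhds p, ‖q.2‖ < ‖p.2‖ + 1 :=
      continuous_snd.norm.continuousAt.eventually_lt_const (by simp)
    filter_upwards [h] with q hq
    refine .of_forall fun θ => ?_
    by_cases hθ : θ ∈ sectorDual (q.1 : Set (EuclideanSpace ℝ (Fin n)))
    · rw [indicator_of_mem hθ, indicator_of_mem hθ.1]
      refine (norm_inner_le_norm _ _).trans ?_
      rw [mem_sphere_zero_iff_norm.1 hθ.1, one_mul]
      exact hq.le
    · rw [indicator_of_notMem hθ, norm_zero]
      exact indicator_nonneg (fun _ _ => by positivity) _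
  · exact (integrable_indicator_iff Metric.isClosed_sphere.measurableSet).2
      (integrableOn_const (surfaceMeasure_sphere_lt_top hn).ne)
  · have hnull := surfaceMeasure_dual_boundary_eq_zero hn hp
    filter_upwards [compl_mem_ae_iff.2 hnull] with θ hθ
    by_cases hsph : θ ∈ Metric.sphere (0 : EuclideanSpace ℝ (Fin n)) 1
    swap
    · refine (continuousAt_const (y := (0 : ℝ))).congr (.of_forall fun q => ?_)
      exact (indicator_of_notMem (fun h => hsph h.1) _).symm
    by_cases hpos : ∀ d ∈ (p.1 : Set (EuclideanSpace ℝ (Fin n))), 0 < ⟪θ, d⟫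
    · have hU : IsOpen {d : EuclideanSpace ℝ (Fin n) | 0 < ⟪θ, d⟫} :=
        isOpen_lt (by fun_prop) (by fun_prop)
      have hev := continuousAt_fst.eventually_mem (x := p)
        ((TopologicalSpace.NonemptyCompacts.isOpen_subsets_of_isOpen hU).mem_nhds hpos)
      have hc : ContinuousAt (fun q : TopologicalSpace.NonemptyCompacts
          (EuclideanSpace ℝ (Fin n)) × EuclideanSpace ℝ (Fin n) => ⟪θ, q.2⟫) p := by fun_prop
      refine hc.congr ?_
      filter_upwards [hev] with q hq
      rw [indicator_of_mem]
      exact ⟨hsph, fun d hd => (hq hd).le⟩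
    · obtain ⟨d, hd, hθd⟩ : ∃ d ∈ (p.1 : Set (EuclideanSpace ℝ (Fin n))), ⟪θ, d⟫ < 0 := by
        push Not at hpos
        obtain ⟨d, hd, hle⟩ := hpos
        by_contra! hall
        exact hθ ⟨hsph, hall, d, hd, le_antisymm hle (hall d hd)⟩
      have hU : IsOpen {d : EuclideanSpace ℝ (Fin n) | ⟪θ, d⟫ < 0} :=
        isOpen_lt (by fun_prop) (by fun_prop)
      have hev := continuousAt_fst.eventually_mem (x := p)
        ((TopologicalSpace.NonemptyCompacts.isOpen_inter_nonempty_of_isOpen hU).mem_nhds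
          ⟨d, hd, hθd⟩)
      refine (continuousAt_const (y := (0 : ℝ))).congr ?_
      filter_upwards [hev] with q hq
      obtain ⟨c, hc, hlt⟩ := hq
      rw [indicator_of_notMem]
      exact fun h => absurd (h.2 c hc) (not_le.2 hlt)

/-- Pairs `(D, u)` of a nonempty compact subset `D` of the sphere with pairwise nonnegative inner
products and a point `u ∈ D`. -/
def acutePairs (n : ℕ) :
    Set (TopologicalSpace.NonemptyCompacts (EuclideanSpace ℝ (Fin n)) ×
      EuclideanSpace ℝ (Fin n)) :=
  {p | (p.1 : Set (EuclideanSpace ℝ (Fin n))) ⊆ Metric.sphere 0 1 ∧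
    (∀ a ∈ p.1, ∀ b ∈ p.1, 0 ≤ ⟪a, b⟫) ∧ p.2 ∈ p.1}

lemma isClosed_setOf_acute {E : Type*} [NormedAddCommGroup E] [InnerProductSpace ℝ E] :
    IsClosed {D : TopologicalSpace.NonemptyCompacts E | ∀ a ∈ D, ∀ b ∈ D, 0 ≤ ⟪a, b⟫} := by
  rw [← isOpen_compl_iff, isOpen_iff_mem_nhds]
  intro D hD
  simp only [mem_compl_iff, mem_ofPred_eq, not_forall, not_le] at hD
  obtain ⟨a, ha, b, hb, hab⟩ := hD
  have hopen : IsOpen {q : E × E | ⟪q.1, q.2⟫ < 0} := isOpen_lt (by fun_prop) (by fun_prop)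
  obtain ⟨U, V, hU, haU, hV, hbV, hUV⟩ := mem_nhds_prod_iff'.1 (hopen.mem_nhds (x := (a, b)) hab)
  filter_upwards [
    (TopologicalSpace.NonemptyCompacts.isOpen_inter_nonempty_of_isOpen hU).mem_nhds ⟨a, ha, haU⟩,
    (TopologicalSpace.NonemptyCompacts.isOpen_inter_nonempty_of_isOpen hV).mem_nhds ⟨b, hb, hbV⟩]
    with D' ⟨c, hc, hcU⟩ ⟨d, hd, hdV⟩ hacute
  exact absurd (hacute c hc d hd) (not_le.2 (hUV (mk_mem_prod hcU hdV)))

lemma isClosed_setOf_snd_mem_fst {X : Type*} [TopologicalSpace X] [T2Space X] :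
    IsClosed {p : TopologicalSpace.NonemptyCompacts X × X | p.2 ∈ p.1} := by
  have h : Continuous fun p : TopologicalSpace.NonemptyCompacts X × X =>
      (({p.2} : TopologicalSpace.NonemptyCompacts X), p.1) :=
    (TopologicalSpace.NonemptyCompacts.isEmbedding_singleton.continuous.comp
      continuous_snd).prodMk continuous_fst
  rw [← isOpen_compl_iff]
  convert! TopologicalSpace.NonemptyCompacts.isOpen_setOfPred_disjoint_coe.preimage h using 1
  ext p
  simp

lemma isCompact_acutePairs : IsCompact (acutePairs n) := by
  have hK := (TopologicalSpace.NonemptyCompacts.isCompact_subsets_of_isCompact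
    (isCompact_sphere (0 : EuclideanSpace ℝ (Fin n)) 1)).prod
    (isCompact_sphere (0 : EuclideanSpace ℝ (Fin n)) 1)
  have hclosed := (isClosed_setOf_acute (E := EuclideanSpace ℝ (Fin n))).preimage
    (continuous_fst (Y := EuclideanSpace ℝ (Fin n)))
  have hmem := isClosed_setOf_snd_mem_fst (X := EuclideanSpace ℝ (Fin n))
  refine hK.of_isClosed_subset ?_ fun p hp => ⟨hp.1, hp.1 hp.2.2⟩
  have hsph := (TopologicalSpace.NonemptyCompacts.isClosed_subsets_of_isClosed
    (Metric.isClosed_sphere (x := (0 : EuclideanSpace ℝ (Fin n))) (ε := 1))).preimage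
    (continuous_fst (Y := EuclideanSpace ℝ (Fin n)))
  exact hsph.inter (hclosed.inter hmem)

lemma exists_isMinOn_acutePairs (hn : n ≠ 0) :
    ∃ p ∈ acutePairs n, IsMinOn (fun q : TopologicalSpace.NonemptyCompacts
      (EuclideanSpace ℝ (Fin n)) × EuclideanSpace ℝ (Fin n) =>
        PhiFun (sectorDual (q.1 : Set (EuclideanSpace ℝ (Fin n)))) q.2) (acutePairs n) p := by
  refine isCompact_acutePairs.exists_isMinOn ?_ fun p hp =>
    (continuousAt_phiFun_sectorDual hn p fun h => by simpa using hp.1 h).continuousWithinAt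
  have : Nonempty (Fin n) := ⟨⟨0, Nat.pos_of_ne_zero hn⟩⟩
  obtain ⟨e, he⟩ := exists_norm_eq (EuclideanSpace ℝ (Fin n)) (zero_le_one (α := ℝ))
  refine ⟨({e}, e), ?_, ?_, ?_⟩
  · simpa using he
  · simp
  · simp

lemma sectorDual_sectorDual_subset_of_acute (hD : ∀ a ∈ D, ∀ b ∈ D, 0 ≤ ⟪a, b⟫)
    (hsph : D ⊆ Metric.sphere 0 1) : sectorDual (sectorDual D) ⊆ sectorDual D :=
  fun _ hy => ⟨hy.1, fun d hd => hy.2 d ⟨hsph hd, fun b hb => hD d hd b hb⟩⟩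

end Sectors

/-- `Φ` has a positive minimum on the class of sectors containing
their dual; any minimizing pair `(S₀, u₀)` satisfies `S₀ = S₀*` and
`u₀ ∈ ∂S₀` (the boundary of `S₀` relative to the sphere). -/
theorem phi_has_positive_min {n : ℕ} (hn : 2 ≤ n) :
    ∃ S₀ : Set (EuclideanSpace ℝ (Fin n)), ∃ u₀ : EuclideanSpace ℝ (Fin n),
      IsSector S₀ ∧ sectorDual S₀ ⊆ S₀ ∧ u₀ ∈ sectorDual S₀ ∧
      0 < PhiFun S₀ u₀ ∧
      (∀ (S : Set (EuclideanSpace ℝ (Fin n))) (u : EuclideanSpace ℝ (Fin n)),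
        IsSector S → sectorDual S ⊆ S → u ∈ sectorDual S →
        PhiFun S₀ u₀ ≤ PhiFun S u) ∧
      ∀ (S : Set (EuclideanSpace ℝ (Fin n))) (u : EuclideanSpace ℝ (Fin n)), IsSector S → sectorDual S ⊆ S → u ∈ sectorDual S →
        PhiFun S u = PhiFun S₀ u₀ →
          S = sectorDual S ∧
          u ∈ closure S ∩ closure (Metric.sphere (0 : EuclideanSpace ℝ (Fin n)) 1 \ S) := by
  have hn0 : n ≠ 0 := by omega
  obtain ⟨⟨D, u₀⟩, ⟨hDsph, hacute, hu₀⟩, hmin⟩ := exists_isMinOn_acutePairs hn0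
  have hmin' : ∀ (S : Set (EuclideanSpace ℝ (Fin n))) (u : EuclideanSpace ℝ (Fin n)),
      IsSector S → sectorDual S ⊆ S → u ∈ sectorDual S →
        PhiFun (sectorDual (D : Set (EuclideanSpace ℝ (Fin n)))) u₀ ≤ PhiFun S u := by
    intro S u hS hdual hu
    have h := hmin (a := (⟨⟨sectorDual S, isCompact_sectorDual⟩, hS.nonempty_sectorDual⟩, u))
      ⟨sectorDual_subset_sphere, fun a ha b hb => ha.2 b (hdual hb), hu⟩
    change _ ≤ PhiFun (sectorDual (sectorDual S)) u at h
    rwa [hS.sectorDual_sectorDual ⟨u, hdual hu⟩] at h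
  have hsector := isSector_sectorDual D.nonempty hDsph
  have hdual := sectorDual_sectorDual_subset_of_acute hacute hDsph
  have hu₀dual : u₀ ∈ sectorDual (sectorDual (D : Set (EuclideanSpace ℝ (Fin n)))) :=
    ⟨hDsph hu₀, fun x hx => by rw [real_inner_comm]; exact hx.2 u₀ hu₀⟩
  refine ⟨sectorDual D, u₀, hsector, hdual, hu₀dual, hsector.phiFun_pos hn0 hdual hu₀dual, hmin',
    fun S u hS hSdual hu heq => ?_⟩
  have hself : S = sectorDual S := by
    by_contra hne
    obtain ⟨T, hT, hTdual, huT, hlt⟩ := hS.exists_phiFun_lt hn0 hSdual hu hne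
    linarith [hmin' T u hT hTdual huT]
  refine ⟨hself, subset_closure (hSdual hu), ?_⟩
  by_contra hint
  obtain ⟨v, hv, hlt⟩ := hS.exists_phiFun_lt_of_interior hn hself hu hint
  linarith [hmin' S v hS hSdual hv]
end

section
/- Let K ⊂ ℝⁿ be a convex body and for p ∈ ℝⁿ let K^p = co(K ∪ {p}) be the cap body. Then p ↦ w(K^p) (the mean width of K^p) is a convex function of p, and for p ∉ ∂K it is differentiable with gradient ∇_p w(K^p) = (2/ω_n) ∫_{N̂(p)} θ dσ(θ), where N̂(p) = N_{K^p}(p) ∩ S^{n-1} is the normal sector of K^p at p. -/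
open RealInnerProductSpace Set MeasureTheory

/-- The support function of a set. -/
noncomputable def suppFn {n : ℕ} (K : Set (EuclideanSpace ℝ (Fin n)))
    (θ : EuclideanSpace ℝ (Fin n)) : ℝ :=
  sSup ((fun y => ⟪θ, y⟫) '' K)

/-- The mean width `w(K) = (2/ω_n) ∫_{S^{n-1}} h_K dσ`. -/
noncomputable def meanWidth {n : ℕ} (K : Set (EuclideanSpace ℝ (Fin n))) : ℝ :=
  2 / sphereMeasureConst n *
    ∫ θ in Metric.sphere (0 : EuclideanSpace ℝ (Fin n)) 1, suppFn K θ ∂(μH[(n : ℝ) - 1])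

open scoped ENNReal NNReal Topology

section CapBodySupport

variable {n : ℕ} {K : Set (EuclideanSpace ℝ (Fin n))}

lemma bddAbove_inner_image (hK : IsCompact K) (θ : EuclideanSpace ℝ (Fin n)) :
    BddAbove ((fun y => ⟪θ, y⟫) '' K) :=
  (hK.image (by fun_prop)).bddAbove

lemma inner_le_suppFn (hK : IsCompact K) (θ : EuclideanSpace ℝ (Fin n))
    {y : EuclideanSpace ℝ (Fin n)} (hy : y ∈ K) : ⟪θ, y⟫ ≤ suppFn K θ :=
  le_csSup (bddAbove_inner_image hK θ) (mem_image_of_mem _ hy)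

lemma suppFn_le (hK : K.Nonempty) {θ : EuclideanSpace ℝ (Fin n)} {c : ℝ}
    (h : ∀ y ∈ K, ⟪θ, y⟫ ≤ c) : suppFn K θ ≤ c :=
  csSup_le (hK.image _) (by rintro _ ⟨y, hy, rfl⟩; exact h y hy)

lemma continuous_suppFn (hK : IsCompact K) : Continuous (suppFn K) :=
  hK.continuous_sSup (f := fun θ y : EuclideanSpace ℝ (Fin n) => ⟪θ, y⟫)
    (by simpa [Function.HasUncurry.uncurry] using
      (continuous_fst.inner continuous_snd :
        Continuous fun q : EuclideanSpace ℝ (Fin n) × EuclideanSpace ℝ (Fin n) => ⟪q.1, q.2⟫))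

lemma convexOn_suppFn (hK : IsCompact K) (hne : K.Nonempty) :
    ConvexOn ℝ univ (suppFn K) := by
  refine ⟨convex_univ, fun θ _ η _ a b ha hb _ => suppFn_le hne fun y hy => ?_⟩
  rw [inner_add_left, real_inner_smul_left, real_inner_smul_left, smul_eq_mul, smul_eq_mul]
  gcongr
  · exact inner_le_suppFn hK θ hy
  · exact inner_le_suppFn hK η hy

lemma suppFn_smul (hK : IsCompact K) (hne : K.Nonempty) {c : ℝ} (hc : 0 < c)
    (θ : EuclideanSpace ℝ (Fin n)) : suppFn K (c • θ) = c * suppFn K θ := by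
  apply le_antisymm
  · refine suppFn_le hne fun y hy => ?_
    rw [real_inner_smul_left]
    gcongr
    exact inner_le_suppFn hK θ hy
  · rw [mul_comm, ← le_div_iff₀ hc]
    refine suppFn_le hne fun y hy => ?_
    rw [le_div_iff₀ hc, mul_comm, ← real_inner_smul_left]
    exact inner_le_suppFn hK _ hy

lemma inner_le_of_mem_convexHull {s : Set (EuclideanSpace ℝ (Fin n))}
    {θ y : EuclideanSpace ℝ (Fin n)} {c : ℝ} (h : ∀ x ∈ s, ⟪θ, x⟫ ≤ c)
    (hy : y ∈ convexHull ℝ s) : ⟪θ, y⟫ ≤ c := by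
  have hc : Convex ℝ {x : EuclideanSpace ℝ (Fin n) | ⟪θ, x⟫ ≤ c} :=
    convex_halfSpace_le (f := fun x => ⟪θ, x⟫)
      ⟨fun x y => inner_add_right θ x y, fun a x => real_inner_smul_right θ x a⟩ c
  exact convexHull_min (t := {x | ⟪θ, x⟫ ≤ c}) h hc hy

lemma suppFn_convexHull_union_singleton (hK : IsCompact K) (hne : K.Nonempty)
    (p θ : EuclideanSpace ℝ (Fin n)) :
    suppFn (convexHull ℝ (K ∪ {p})) θ = max (suppFn K θ) ⟪θ, p⟫ := by
  have hub : ∀ y ∈ convexHull ℝ (K ∪ {p}), ⟪θ, y⟫ ≤ max (suppFn K θ) ⟪θ, p⟫ := by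
    refine fun y hy => inner_le_of_mem_convexHull ?_ hy
    rintro x (hx | rfl)
    · exact (inner_le_suppFn hK θ hx).trans (le_max_left _ _)
    · exact le_max_right _ _
  have hbdd : BddAbove ((fun y => ⟪θ, y⟫) '' convexHull ℝ (K ∪ {p})) :=
    ⟨_, by rintro _ ⟨y, hy, rfl⟩; exact hub y hy⟩
  have hp : p ∈ convexHull ℝ (K ∪ {p}) := subset_convexHull ℝ _ (Or.inr rfl)
  apply le_antisymm (suppFn_le ⟨p, hp⟩ hub)
  refine max_le (suppFn_le hne fun y hy => ?_) (le_csSup hbdd (mem_image_of_mem _ hp))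
  exact le_csSup hbdd (mem_image_of_mem _ (subset_convexHull ℝ _ (Or.inl hy)))

/-- A unit vector lies in the normal cone of the cap body at its apex iff the support function of
the base is dominated by the apex. -/
lemma forall_convexHull_union_inner_sub_le_iff (hK : IsCompact K) (hne : K.Nonempty)
    (p θ : EuclideanSpace ℝ (Fin n)) :
    (∀ y ∈ convexHull ℝ (K ∪ {p}), ⟪θ, y - p⟫ ≤ 0) ↔ suppFn K θ ≤ ⟪θ, p⟫ := by
  simp only [inner_sub_right, sub_nonpos]
  constructor
  · exact fun h => suppFn_le hne fun y hy => h y (subset_convexHull ℝ _ (Or.inl hy))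
  · refine fun h y hy => inner_le_of_mem_convexHull ?_ hy
    rintro x (hx | rfl)
    · exact (inner_le_suppFn hK θ hx).trans h
    · exact le_rfl

lemma inner_lt_suppFn_of_mem_interior (hK : IsCompact K) {p θ : EuclideanSpace ℝ (Fin n)}
    (hp : p ∈ interior K) (hθ : θ ≠ 0) : ⟪θ, p⟫ < suppFn K θ := by
  have hcont : Filter.Tendsto (fun t : ℝ => p + t • θ) (𝓝[>] 0) (𝓝 p) := by
    have : Continuous fun t : ℝ => p + t • θ := by fun_prop
    simpa using (this.tendsto 0).mono_left nhdsWithin_le_nhds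
  obtain ⟨t, htK, ht⟩ :=
    ((hcont.eventually (mem_interior_iff_mem_nhds.1 hp)).and self_mem_nhdsWithin).exists
  have h := inner_le_suppFn hK θ htK
  rw [inner_add_right, real_inner_smul_right] at h
  have : 0 < t * ⟪θ, θ⟫ := mul_pos ht (real_inner_self_pos.2 hθ)
  linarith

lemma exists_suppFn_lt_inner (hK : IsCompact K) (hconv : Convex ℝ K) (hne : K.Nonempty)
    {p : EuclideanSpace ℝ (Fin n)} (hp : p ∉ K) : ∃ u, suppFn K u < ⟪u, p⟫ := by
  obtain ⟨f, c, hfK, hfp⟩ := geometric_hahn_banach_closed_point hconv hK.isClosed hp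
  refine ⟨(InnerProductSpace.toDual ℝ _).symm f, lt_of_le_of_lt (suppFn_le hne fun y hy => ?_)
    (b := c) (by simpa using hfp)⟩
  simpa using (hfK y hy).le

end CapBodySupport

section ConvexLevel

lemma ConvexOn.zero_set_subset_frontier {E : Type*} [AddCommGroup E] [Module ℝ E]
    [TopologicalSpace E] [IsTopologicalAddGroup E] [ContinuousSMul ℝ E] {f : E → ℝ}
    (hf : ConvexOn ℝ univ f) {v : E} (hv : f v < 0) :
    {x | f x = 0} ⊆ frontier {x | f x ≤ 0} := by
  intro x (hx : f x = 0)
  refine ⟨subset_closure hx.le, fun hxi => ?_⟩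
  have hcont : Filter.Tendsto (fun t : ℝ => x + t • (x - v)) (𝓝[>] 0) (𝓝 x) := by
    have : Continuous fun t : ℝ => x + t • (x - v) := by fun_prop
    simpa using (this.tendsto 0).mono_left nhdsWithin_le_nhds
  obtain ⟨t, htf, ht⟩ :=
    ((hcont.eventually (mem_interior_iff_mem_nhds.1 hxi)).and self_mem_nhdsWithin).exists
  have ht' : 0 < t := ht
  have h1 : 0 < 1 + t := by linarith
  have hcomb : (1 / (1 + t)) • (x + t • (x - v)) + (t / (1 + t)) • v = x := by
    match_scalars <;> field_simp <;> ring
  have h := hf.2 (mem_univ (x + t • (x - v))) (mem_univ v)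
    (show 0 ≤ 1 / (1 + t) by positivity) (show 0 ≤ t / (1 + t) by positivity) (by field_simp)
  rw [hcomb, hx, smul_eq_mul, smul_eq_mul] at h
  have hle : f (x + t • (x - v)) ≤ 0 := htf
  have h2 : 1 / (1 + t) * f (x + t • (x - v)) ≤ 0 :=
    mul_nonpos_of_nonneg_of_nonpos (by positivity) hle
  have h3 : t / (1 + t) * f v < 0 := mul_neg_of_pos_of_neg (by positivity) hv
  linarith

lemma ConvexOn.addHaar_zero_set {E : Type*} [NormedAddCommGroup E] [NormedSpace ℝ E]
    [MeasurableSpace E] [BorelSpace E] [FiniteDimensional ℝ E] (μ : Measure E)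
    [μ.IsAddHaarMeasure] {f : E → ℝ} (hf : ConvexOn ℝ univ f) {v : E} (hv : f v < 0) :
    μ {x | f x = 0} = 0 := by
  have hc : Convex ℝ {x | f x ≤ 0} := by simpa using hf.convex_le 0
  exact measure_mono_null (hf.zero_set_subset_frontier hv) (hc.addHaar_frontier μ)

end ConvexLevel

section SphereCharts

lemma norm_inv_smul_sub_inv_smul_le {E : Type*} [NormedAddCommGroup E] [NormedSpace ℝ E]
    {x y : E} (hx : 1 ≤ ‖x‖) (hy : 1 ≤ ‖y‖) :
    ‖‖x‖⁻¹ • x - ‖y‖⁻¹ • y‖ ≤ 2 * ‖x - y‖ := by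
  have hx0 : 0 < ‖x‖ := by linarith
  have hy0 : 0 < ‖y‖ := by linarith
  have h : ‖x‖⁻¹ • x - ‖y‖⁻¹ • y = ‖x‖⁻¹ • (x - y) + (‖x‖⁻¹ - ‖y‖⁻¹) • y := by
    module
  have h2 : ‖(‖x‖⁻¹ - ‖y‖⁻¹) • y‖ ≤ ‖x‖⁻¹ * ‖x - y‖ := by
    have : (‖x‖⁻¹ - ‖y‖⁻¹) * ‖y‖ = ‖x‖⁻¹ * (‖y‖ - ‖x‖) := by field_simp
    rw [norm_smul, Real.norm_eq_abs, ← abs_of_pos hy0, ← abs_mul, abs_of_pos hy0, this, abs_mul,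
      abs_of_pos (inv_pos.2 hx0), norm_sub_rev]
    gcongr
    exact abs_norm_sub_norm_le y x
  have h3 : ‖x‖⁻¹ * ‖x - y‖ ≤ ‖x - y‖ :=
    mul_le_of_le_one_left (norm_nonneg _) (inv_le_one_of_one_le₀ hx)
  calc _ ≤ ‖‖x‖⁻¹ • (x - y)‖ + ‖(‖x‖⁻¹ - ‖y‖⁻¹) • y‖ := h ▸ norm_add_le _ _
    _ ≤ ‖x‖⁻¹ * ‖x - y‖ + ‖x‖⁻¹ * ‖x - y‖ := by
        gcongr
        rw [norm_smul, norm_inv, norm_norm]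
    _ ≤ _ := by linarith

/-- The affine embedding of `ℝᵐ` as the hyperplane `xᵢ = s` of `ℝᵐ⁺¹`. -/
noncomputable def hyperplaneEmb {m : ℕ} (i : Fin (m + 1)) (s : ℝ) (y : Fin m → ℝ) :
    EuclideanSpace ℝ (Fin (m + 1)) :=
  WithLp.toLp 2 (i.insertNth s y)

variable {m : ℕ}

lemma hyperplaneEmb_succAbove {i : Fin (m + 1)} {s : ℝ} {x : EuclideanSpace ℝ (Fin (m + 1))}
    (hx : x i = s) : hyperplaneEmb i s (fun j => x (i.succAbove j)) = x := by
  ext k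
  refine Fin.succAboveCases i ?_ (fun j => ?_) k <;> simp [hyperplaneEmb, hx]

lemma hyperplaneEmb_combo (i : Fin (m + 1)) (s : ℝ) (y z : Fin m → ℝ) {a b : ℝ}
    (hab : a + b = 1) :
    hyperplaneEmb i s (a • y + b • z) = a • hyperplaneEmb i s y + b • hyperplaneEmb i s z := by
  ext k
  refine Fin.succAboveCases i ?_ (fun j => ?_) k
  · simp [hyperplaneEmb, ← add_mul, hab]
  · simp [hyperplaneEmb]

lemma exists_lipschitzWith_hyperplaneEmb (i : Fin (m + 1)) (s : ℝ) :
    ∃ C, LipschitzWith C (hyperplaneEmb i s) := by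
  have h : LipschitzWith 1 (fun y : Fin m → ℝ => (i.insertNth s y : Fin (m + 1) → ℝ)) := by
    refine LipschitzWith.of_dist_le_mul fun y z => ?_
    rw [NNReal.coe_one, one_mul, dist_pi_le_iff dist_nonneg]
    intro k
    refine Fin.succAboveCases i ?_ (fun j => ?_) k
    · simp
    · simpa using dist_le_pi_dist y z j
  exact ⟨_, (PiLp.lipschitzWith_toLp 2 (fun _ : Fin (m + 1) => ℝ)).comp h⟩

lemma one_le_norm_hyperplaneEmb (i : Fin (m + 1)) {s : ℝ} (hs : |s| = 1) (y : Fin m → ℝ) :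
    1 ≤ ‖hyperplaneEmb i s y‖ := by
  simpa [hyperplaneEmb, hs] using PiLp.norm_apply_le (hyperplaneEmb i s y) i

lemma exists_lipschitzWith_normalize_hyperplaneEmb (i : Fin (m + 1)) {s : ℝ} (hs : |s| = 1) :
    ∃ C, LipschitzWith C
      (fun y => ‖hyperplaneEmb i s y‖⁻¹ • hyperplaneEmb i s y) := by
  obtain ⟨C, hC⟩ := exists_lipschitzWith_hyperplaneEmb i s
  refine ⟨2 * C, LipschitzWith.of_dist_le_mul fun y z => ?_⟩
  have h := norm_inv_smul_sub_inv_smul_le (one_le_norm_hyperplaneEmb i hs y)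
    (one_le_norm_hyperplaneEmb i hs z)
  have h2 := hC.dist_le_mul y z
  rw [dist_eq_norm] at h2
  rw [dist_eq_norm]
  push_cast
  linarith

lemma hausdorffMeasure_image_normalize_hyperplaneEmb_le (i : Fin (m + 1)) {s : ℝ}
    (hs : |s| = 1) : ∃ C : ℝ≥0∞, C ≠ ∞ ∧ ∀ A : Set (Fin m → ℝ),
      μH[(m : ℝ)] ((fun y => ‖hyperplaneEmb i s y‖⁻¹ • hyperplaneEmb i s y) '' A)
        ≤ C * volume A := by
  obtain ⟨C, hC⟩ := exists_lipschitzWith_normalize_hyperplaneEmb i hs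
  refine ⟨(C : ℝ≥0∞) ^ (m : ℝ), by simp, fun A => ?_⟩
  have h := hC.hausdorffMeasure_image_le (d := (m : ℝ)) (by positivity) A
  have hvol : (μH[(m : ℝ)] : Measure (Fin m → ℝ)) = volume := by
    simpa using hausdorffMeasure_pi_real (ι := Fin m)
  rwa [hvol] at h

/-- The unit sphere is covered by the radial projections of the faces of the cube `[-1, 1]ᵐ⁺¹`. -/
lemma exists_eq_normalize_hyperplaneEmb {θ : EuclideanSpace ℝ (Fin (m + 1))} (hθ : ‖θ‖ = 1) :
    ∃ i : Fin (m + 1), ∃ s ∈ ({1, -1} : Set ℝ), ∃ y ∈ Icc (-1 : Fin m → ℝ) 1,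
      θ = ‖hyperplaneEmb i s y‖⁻¹ • hyperplaneEmb i s y ∧
      ∃ c : ℝ, 0 < c ∧ hyperplaneEmb i s y = c • θ := by
  obtain ⟨i, hi⟩ := Finite.exists_max fun j => |θ j|
  have hi0 : 0 < |θ i| := by
    refine abs_pos.2 fun h0 => ?_
    have : θ = 0 := by
      ext j
      simpa [h0] using hi j
    simp [this] at hθ
  have hy : hyperplaneEmb i (SignType.sign (θ i) : ℝ) (fun j => (|θ i|⁻¹ • θ) (i.succAbove j))
      = |θ i|⁻¹ • θ := by
    apply hyperplaneEmb_succAbove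
    rw [PiLp.smul_apply, smul_eq_mul, inv_mul_eq_div, div_eq_iff hi0.ne', sign_mul_abs]
  refine ⟨i, (SignType.sign (θ i) : ℝ), ?_, _, ?_, ?_, |θ i|⁻¹, inv_pos.2 hi0, hy⟩
  · rcases lt_or_gt_of_ne (abs_pos.1 hi0) with h | h <;> simp [h]
  · rw [mem_Icc, Pi.le_def, Pi.le_def, ← forall_and]
    intro j
    rw [Pi.neg_apply, Pi.one_apply, ← abs_le, PiLp.smul_apply, smul_eq_mul, abs_mul, abs_inv,
      abs_abs, inv_mul_eq_div, div_le_one hi0]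
    exact hi _
  · rw [hy, norm_smul, hθ, norm_inv, Real.norm_eq_abs, abs_abs, mul_one, inv_inv, smul_smul,
      mul_inv_cancel₀ hi0.ne', one_smul]

lemma hausdorffMeasure_sphere_lt_top_s15 {n : ℕ} (hn : n ≠ 0) :
    μH[(n : ℝ) - 1] (Metric.sphere (0 : EuclideanSpace ℝ (Fin n)) 1) < ∞ := by
  obtain ⟨m, rfl⟩ := Nat.exists_eq_succ_of_ne_zero hn
  have hm : ((m.succ : ℕ) : ℝ) - 1 = m := by simp
  rw [hm]
  have hsub : Metric.sphere (0 : EuclideanSpace ℝ (Fin m.succ)) 1 ⊆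
      ⋃ i : Fin (m + 1), ⋃ s ∈ ({1, -1} : Set ℝ),
        (fun y => ‖hyperplaneEmb i s y‖⁻¹ • hyperplaneEmb i s y) ''
          Icc (-1 : Fin m → ℝ) 1 := by
    intro θ hθ
    obtain ⟨i, s, hs, y, hy, hθy, -⟩ :=
      exists_eq_normalize_hyperplaneEmb (mem_sphere_zero_iff_norm.1 hθ)
    simp only [mem_iUnion]
    exact ⟨i, s, hs, y, hy, hθy.symm⟩
  refine (measure_mono hsub).trans_lt ?_
  refine (measure_iUnion_le _).trans_lt ?_
  rw [tsum_fintype]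
  refine ENNReal.sum_lt_top.2 fun i _ => measure_biUnion_lt_top (by simp) fun s hs => ?_
  obtain ⟨C, hC, h⟩ := hausdorffMeasure_image_normalize_hyperplaneEmb_le i (s := s)
    (by rcases hs with rfl | rfl <;> simp)
  exact (h _).trans_lt (ENNReal.mul_lt_top hC.lt_top isCompact_Icc.measure_lt_top)

/-- If a convex, positively homogeneous function takes a negative value, then it vanishes almost
nowhere on the unit sphere. -/
lemma hausdorffMeasure_sphere_zero_set {n : ℕ} (hn : n ≠ 0)
    {g : EuclideanSpace ℝ (Fin n) → ℝ} (hg : ConvexOn ℝ univ g)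
    (hhom : ∀ c : ℝ, 0 < c → ∀ θ, g (c • θ) = c * g θ)
    {u : EuclideanSpace ℝ (Fin n)} (hu : g u < 0) :
    μH[(n : ℝ) - 1] {θ ∈ Metric.sphere (0 : EuclideanSpace ℝ (Fin n)) 1 | g θ = 0} = 0 := by
  obtain ⟨m, rfl⟩ := Nat.exists_eq_succ_of_ne_zero hn
  have hm : ((m.succ : ℕ) : ℝ) - 1 = m := by simp
  rw [hm]
  have hsub : {θ ∈ Metric.sphere (0 : EuclideanSpace ℝ (Fin m.succ)) 1 | g θ = 0} ⊆
      ⋃ i : Fin (m + 1), ⋃ s ∈ ({1, -1} : Set ℝ),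
        (fun y => ‖hyperplaneEmb i s y‖⁻¹ • hyperplaneEmb i s y) ''
          {y | g (hyperplaneEmb i s y) = 0} := by
    rintro θ ⟨hθ, hgθ⟩
    obtain ⟨i, s, hs, y, -, hθy, c, hc, hyc⟩ :=
      exists_eq_normalize_hyperplaneEmb (mem_sphere_zero_iff_norm.1 hθ)
    simp only [mem_iUnion]
    exact ⟨i, s, hs, y, by simp [hyc, hhom c hc, hgθ], hθy.symm⟩
  refine measure_mono_null hsub (measure_iUnion_null fun i => ?_)
  refine (measure_biUnion_null_iff (by simp)).2 fun s hs => ?_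
  have hs1 : |s| = 1 := by rcases hs with rfl | rfl <;> simp
  have hss : s * s = 1 := by rcases hs with rfl | rfl <;> simp
  obtain ⟨C, -, h⟩ := hausdorffMeasure_image_normalize_hyperplaneEmb_le i hs1
  refine le_antisymm ((h _).trans ?_) zero_le
  suffices volume {y | g (hyperplaneEmb i s y) = 0} = 0 by simp [this]
  rcases eq_empty_or_nonempty {y | g (hyperplaneEmb i s y) = 0} with h0 | ⟨y₀, hy₀⟩
  · simp [h0]
  replace hy₀ : g (hyperplaneEmb i s y₀) = 0 := hy₀
  have hconv : ConvexOn ℝ univ fun y => g (hyperplaneEmb i s y) := by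
    refine ⟨convex_univ, fun y _ z _ a b ha hb hab => ?_⟩
    simp only [hyperplaneEmb_combo i s y z hab]
    exact hg.2 (mem_univ _) (mem_univ _) ha hb hab
  obtain ⟨ε, hεpos, hε⟩ : ∃ ε : ℝ, 0 < 1 + ε * (s * u i) ∧ 0 < ε := by
    have hcont : Filter.Tendsto (fun ε : ℝ => 1 + ε * (s * u i)) (𝓝[>] 0) (𝓝 1) := by
      have : Continuous fun ε : ℝ => 1 + ε * (s * u i) := by fun_prop
      simpa using (this.tendsto 0).mono_left nhdsWithin_le_nhds
    exact ((hcont.eventually (lt_mem_nhds one_pos)).and self_mem_nhdsWithin).exists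
  set c := 1 + ε * (s * u i) with hc
  set w := c⁻¹ • (hyperplaneEmb i s y₀ + ε • u) with hw
  have hwi : w i = s := by
    have : s + ε * u i = c * s := by
      linear_combination (-ε * u i) * hss
    simp [hw, hyperplaneEmb, ← mul_add, this, hεpos.ne']
  have hgw : g w < 0 := by
    rw [hw, hhom _ (inv_pos.2 hεpos)]
    refine mul_neg_of_pos_of_neg (inv_pos.2 hεpos) ?_
    have h2 := hg.2 (mem_univ ((2 : ℝ) • hyperplaneEmb i s y₀)) (mem_univ ((2 * ε) • u))
      (show (0 : ℝ) ≤ 1 / 2 by norm_num) (show (0 : ℝ) ≤ 1 / 2 by norm_num) (by norm_num)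
    rw [smul_smul, smul_smul, hhom _ two_pos, hhom _ (by positivity), hy₀] at h2
    have h3 : ε * g u < 0 := mul_neg_of_pos_of_neg hε hu
    have e1 : (1 / 2 : ℝ) * 2 = 1 := by norm_num
    have e2 : (1 / 2 : ℝ) * (2 * ε) = ε := by ring
    rw [e1, e2, one_smul, smul_eq_mul, smul_eq_mul] at h2
    linarith
  exact hconv.addHaar_zero_set volume (v := fun j => w (i.succAbove j))
    (by simpa only [hyperplaneEmb_succAbove hwi] using hgw)

end SphereCharts

lemma abs_inner_sub_inner_le_of_mem_sphere {n : ℕ} {θ : EuclideanSpace ℝ (Fin n)}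
    (hθ : θ ∈ Metric.sphere 0 1) (x y : EuclideanSpace ℝ (Fin n)) :
    |⟪θ, x⟫ - ⟪θ, y⟫| ≤ ‖x - y‖ := by
  rw [← inner_sub_right]
  simpa [mem_sphere_zero_iff_norm.1 hθ] using abs_real_inner_le_norm θ (x - y)

lemma sphereMeasureConst_nonneg (n : ℕ) : 0 ≤ sphereMeasureConst n :=
  div_nonneg (by positivity) (Real.Gamma_nonneg_of_nonneg (by positivity))

/-- For a point `p` off the boundary of `K`, almost no hyperplane through `p` supports `K`. -/
lemma ae_suppFn_ne_inner {n : ℕ} (hn : n ≠ 0) {K : Set (EuclideanSpace ℝ (Fin n))}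
    (hK : IsCompact K) (hconv : Convex ℝ K) (hne : K.Nonempty) {p : EuclideanSpace ℝ (Fin n)}
    (hp : p ∉ frontier K) :
    ∀ᵐ θ ∂(μH[(n : ℝ) - 1]).restrict (Metric.sphere (0 : EuclideanSpace ℝ (Fin n)) 1),
      suppFn K θ ≠ ⟪θ, p⟫ := by
  rw [ae_restrict_iff' Metric.isClosed_sphere.measurableSet]
  by_cases hpK : p ∈ K
  · have hpi : p ∈ interior K := by
      by_contra h
      exact hp ⟨subset_closure hpK, h⟩
    refine Filter.Eventually.of_forall fun θ hθ => (inner_lt_suppFn_of_mem_interior hK hpi ?_).ne'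
    exact ne_zero_of_mem_unit_sphere ⟨θ, hθ⟩
  · obtain ⟨u, hu⟩ := exists_suppFn_lt_inner hK hconv hne hpK
    have hg : ConvexOn ℝ univ fun θ => suppFn K θ - ⟪θ, p⟫ := by
      refine (convexOn_suppFn hK hne).sub ⟨convex_univ, fun θ _ η _ a b _ _ _ => ?_⟩
      simp [inner_add_left, real_inner_smul_left]
    have h := hausdorffMeasure_sphere_zero_set hn hg
      (fun c hc θ => by rw [suppFn_smul hK hne hc, real_inner_smul_left]; ring)
      (u := u) (by linarith)
    refine measure_mono_null ?_ h
    intro θ hθ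
    simpa [sub_eq_zero] using hθ


/-- `p ↦ w(K^p)` (mean width of the cap body) is convex, and for
`p ∉ ∂K` it is differentiable with gradient `(2/ω_n) ∫_{N̂(p)} θ dσ(θ)`. -/
theorem capBody_meanWidth_convex_grad {n : ℕ} (hn : 2 ≤ n)
    (K : Set (EuclideanSpace ℝ (Fin n)))
    (hKcomp : IsCompact K) (hKconv : Convex ℝ K) (hKne : K.Nonempty) :
    ConvexOn ℝ univ (fun p => meanWidth (convexHull ℝ (K ∪ {p}))) ∧
    ∀ p ∉ frontier K,
      HasGradientAt (fun p => meanWidth (convexHull ℝ (K ∪ {p})))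
        ((2 / sphereMeasureConst n) •
          ∫ θ in {θ ∈ Metric.sphere (0 : EuclideanSpace ℝ (Fin n)) 1 |
              ∀ y ∈ convexHull ℝ (K ∪ {p}), ⟪θ, y - p⟫ ≤ 0},
            θ ∂(μH[(n : ℝ) - 1])) p := by
  have hn0 : n ≠ 0 := by omega
  set S := Metric.sphere (0 : EuclideanSpace ℝ (Fin n)) 1 with hS
  set μ : Measure (EuclideanSpace ℝ (Fin n)) := (μH[(n : ℝ) - 1]).restrict S with hμ
  have hSm : MeasurableSet S := Metric.isClosed_sphere.measurableSet
  have : IsFiniteMeasure μ := ⟨by simpa [hμ] using hausdorffMeasure_sphere_lt_top_s15 hn0⟩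
  have hw : (fun p => meanWidth (convexHull ℝ (K ∪ {p}))) = fun p =>
      2 / sphereMeasureConst n * ∫ θ, max (suppFn K θ) ⟪θ, p⟫ ∂μ := by
    funext p
    simp only [meanWidth, suppFn_convexHull_union_singleton hKcomp hKne, hμ, hS]
  have hcont : ∀ p : EuclideanSpace ℝ (Fin n), Continuous fun θ => max (suppFn K θ) ⟪θ, p⟫ :=
    fun p => (continuous_suppFn hKcomp).max (by fun_prop)
  have hint : ∀ p : EuclideanSpace ℝ (Fin n),
      Integrable (fun θ => max (suppFn K θ) ⟪θ, p⟫) μ := by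
    intro p
    obtain ⟨C, hC⟩ := (isCompact_sphere (0 : EuclideanSpace ℝ (Fin n))
      1).exists_bound_of_continuousOn
      (hcont p).continuousOn
    exact Integrable.of_bound (hcont p).aestronglyMeasurable C (ae_restrict_of_forall_mem hSm hC)
  have hconst : 0 ≤ 2 / sphereMeasureConst n :=
    div_nonneg zero_le_two (sphereMeasureConst_nonneg n)
  rw [hw]
  refine ⟨?_, fun p hp => ?_⟩
  · refine ⟨convex_univ, fun p _ q _ a b ha hb hab => ?_⟩
    have h : ∫ θ, max (suppFn K θ) ⟪θ, a • p + b • q⟫ ∂μ ≤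
        a * ∫ θ, max (suppFn K θ) ⟪θ, p⟫ ∂μ + b * ∫ θ, max (suppFn K θ) ⟪θ, q⟫ ∂μ := by
      rw [← integral_const_mul, ← integral_const_mul,
        ← integral_add ((hint p).const_mul a) ((hint q).const_mul b)]
      refine integral_mono (hint _) (((hint p).const_mul a).add ((hint q).const_mul b))
        fun θ => max_le ?_ ?_
      · calc suppFn K θ = a * suppFn K θ + b * suppFn K θ := by rw [← add_mul, hab, one_mul]
          _ ≤ _ := by
            gcongr <;> exact le_max_left _ _
      · rw [inner_add_right, real_inner_smul_right, real_inner_smul_right]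
        dsimp only
        gcongr <;> exact le_max_right _ _
    calc _ ≤ 2 / sphereMeasureConst n * (a * ∫ θ, max (suppFn K θ) ⟪θ, p⟫ ∂μ +
          b * ∫ θ, max (suppFn K θ) ⟪θ, q⟫ ∂μ) := mul_le_mul_of_nonneg_left h hconst
      _ = _ := by simp only [smul_eq_mul]; ring
  · set N : Set (EuclideanSpace ℝ (Fin n)) := {θ | suppFn K θ ≤ ⟪θ, p⟫} with hN
    have hNm : MeasurableSet N :=
      (isClosed_le (continuous_suppFn hKcomp) (by fun_prop)).measurableSet
    have hsector : {θ ∈ S | ∀ y ∈ convexHull ℝ (K ∪ {p}), ⟪θ, y - p⟫ ≤ 0} = N ∩ S := by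
      ext θ
      simp only [forall_convexHull_union_inner_sub_le_iff hKcomp hKne, hN, mem_inter_iff,
        mem_ofPred_eq]
      exact and_comm
    rw [hsector, ← Measure.restrict_restrict hNm, ← hμ, ← integral_indicator hNm]
    have hid : Integrable (N.indicator fun θ => θ) μ := by
      refine Integrable.indicator ?_ hNm
      refine Integrable.of_bound continuous_id.aestronglyMeasurable 1
        (ae_restrict_of_forall_mem hSm fun θ hθ => ?_)
      simpa using (mem_sphere_zero_iff_norm.1 hθ).le
    have hae := ae_suppFn_ne_inner hn0 hKcomp hKconv hKne hp
    have hderiv := hasFDerivAt_integral_of_dominated_loc_of_lip' (μ := μ) (𝕜 := ℝ)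
      (F := fun q θ => max (suppFn K θ) ⟪θ, q⟫)
      (F' := fun θ => innerSL ℝ (N.indicator (fun θ => θ) θ)) (x₀ := p) (s := univ)
      (bound := fun _ => 1) Filter.univ_mem (fun q _ => (hcont q).aestronglyMeasurable) (hint p)
      ((innerSL ℝ).continuous.comp_aestronglyMeasurable hid.aestronglyMeasurable)
      (ae_restrict_of_forall_mem hSm fun θ hθ q _ => by
        rw [one_mul, Real.norm_eq_abs]
        refine (abs_max_sub_max_le_max _ _ _ _).trans ?_
        rw [sub_self, abs_zero]
        exact max_le (norm_nonneg _) (abs_inner_sub_inner_le_of_mem_sphere hθ q p))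
      (integrable_const 1)
      (by
        filter_upwards [hae] with θ hθ
        have hc : Continuous fun q : EuclideanSpace ℝ (Fin n) => ⟪θ, q⟫ := by fun_prop
        rcases lt_or_gt_of_ne hθ with h | h
        · rw [indicator_of_mem (show θ ∈ N from h.le)]
          refine (innerSL ℝ θ).hasFDerivAt.congr_of_eventuallyEq ?_
          filter_upwards [hc.continuousAt.eventually (lt_mem_nhds h)] with q hq
          simpa using hq.le
        · rw [indicator_of_notMem (show θ ∉ N from not_le.2 h), map_zero]
          refine (hasFDerivAt_const (suppFn K θ) p).congr_of_eventuallyEq ?_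
          filter_upwards [hc.continuousAt.eventually (gt_mem_nhds h)] with q hq
          simpa using hq.le)
    rw [hasGradientAt_iff_hasFDerivAt]
    refine (hderiv.2.const_mul (2 / sphereMeasureConst n)).congr_fderiv ?_
    ext1 v
    rw [smul_apply, ContinuousLinearMap.integral_apply hderiv.1]
    simp only [InnerProductSpace.toDual_apply_apply, innerSL_apply_apply, real_inner_smul_left,
      smul_eq_mul]
    rw [real_inner_comm, ← integral_inner hid v]
    simp only [real_inner_comm]
end
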